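/- arXiv:math/9912181 — 12 statements merged into one kernel-verified Lean document; each statement's English description precedes it below -/
import Mathlib

section
/- Let (V, Ω) be a real symplectic vector space of dimension 2n (n ≥ 2) which is the Ω-orthogonal direct sum V = V₁ ⊕ V₂ of two nonzero subspaces on each of which Ω restricts nondegenerately. Let A be an infinitesimally symplectic endomorphism of V with A(V₁) ⊆ V₁ and A(V₂) ⊆ V₂, and let R be the Ricci-type curvature operator associated to A. If R(X,Y)Z = 0 whenever X,Y ∈ V₁ and Z ∈ V₂, and R(X,Y)Z = 0 whenever X,Y ∈ V₂ and Z ∈ V₁, then A = 0 and consequently R(X,Y) = 0 for all X,Y ∈ V. (Linear-algebra core of Theorem 1: a Ricci-type symplectic connection on a product of positive-dimensional symplectic manifolds is flat.) -/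
open Module

/-- If the Ricci-type curvature expression of `A` vanishes on `(X, Y, Z)` for `X, Y ∈ W₁` and
`Z ∈ W₂`, where `W₂` is `A`-invariant and `Ω`-orthogonal to the nonzero subspace `W₁`, on which
`Ω` is nondegenerate, then `A` vanishes on `W₂`. -/
theorem eq_zero_of_ricciType_eq_zero {V : Type*} [AddCommGroup V] [Module ℝ V]
    (Ω : V →ₗ[ℝ] V →ₗ[ℝ] ℝ) (A : V →ₗ[ℝ] V) (W₁ W₂ : Submodule ℝ V) (hW₁ : W₁ ≠ ⊥)
    (horth : ∀ x ∈ W₁, ∀ y ∈ W₂, Ω x y = 0)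
    (hnd : ∀ x ∈ W₁, (∀ y ∈ W₁, Ω x y = 0) → x = 0)
    (hA : ∀ x ∈ W₂, A x ∈ W₂)
    (hR : ∀ X ∈ W₁, ∀ Y ∈ W₁, ∀ Z ∈ W₂,
      (2 * Ω X Y) • A Z + Ω X Z • A Y - Ω Y (A Z) • X - Ω Y Z • A X + Ω X (A Z) • Y = 0) :
    ∀ Z ∈ W₂, A Z = 0 := by
  intro Z hZ
  obtain ⟨X, hX, hX0⟩ := W₁.exists_mem_ne_zero_of_ne_bot hW₁
  obtain ⟨Y, hY, hXY⟩ : ∃ Y ∈ W₁, Ω X Y ≠ 0 := by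
    by_contra! h
    exact hX0 (hnd X hX h)
  have h := hR X hX Y hY Z hZ
  rw [horth X hX Z hZ, horth Y hY Z hZ, horth X hX _ (hA Z hZ), horth Y hY _ (hA Z hZ)] at h
  simpa [hXY] using h

/-- Linear-algebra core of Theorem 1: a Ricci-type symplectic connection on a
product of positive-dimensional symplectic manifolds is flat. -/
theorem stmt_0
    {V : Type*} [AddCommGroup V] [Module ℝ V] [FiniteDimensional ℝ V]
    (n : ℕ) (hn : 2 ≤ n) (hdim : finrank ℝ V = 2 * n)
    (Ω : V →ₗ[ℝ] V →ₗ[ℝ] ℝ)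
    (hΩalt : ∀ x, Ω x x = 0)
    (hΩnd : ∀ x, (∀ y, Ω x y = 0) → x = 0)
    (V₁ V₂ : Submodule ℝ V) (hV₁ : V₁ ≠ ⊥) (hV₂ : V₂ ≠ ⊥)
    (hsup : V₁ ⊔ V₂ = ⊤) (hinf : V₁ ⊓ V₂ = ⊥)
    (horth : ∀ x ∈ V₁, ∀ y ∈ V₂, Ω x y = 0)
    (hnd₁ : ∀ x ∈ V₁, (∀ y ∈ V₁, Ω x y = 0) → x = 0)
    (hnd₂ : ∀ x ∈ V₂, (∀ y ∈ V₂, Ω x y = 0) → x = 0)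
    (A : V →ₗ[ℝ] V)
    (hA : ∀ X Y, Ω (A X) Y + Ω X (A Y) = 0)
    (hA₁ : ∀ x ∈ V₁, A x ∈ V₁) (hA₂ : ∀ x ∈ V₂, A x ∈ V₂)
    (R : V → V → V → V)
    (hR : ∀ X Y Z, R X Y Z = (2 * ((n : ℝ) + 1))⁻¹ •
      ((2 * Ω X Y) • A Z + Ω X Z • A Y - Ω Y (A Z) • X - Ω Y Z • A X + Ω X (A Z) • Y))
    (hR₁₂ : ∀ X ∈ V₁, ∀ Y ∈ V₁, ∀ Z ∈ V₂, R X Y Z = 0)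
    (hR₂₁ : ∀ X ∈ V₂, ∀ Y ∈ V₂, ∀ Z ∈ V₁, R X Y Z = 0) :
    A = 0 ∧ ∀ X Y Z, R X Y Z = 0 := by
  have hc : (2 * ((n : ℝ) + 1))⁻¹ ≠ 0 := by positivity
  have horth' : ∀ x ∈ V₂, ∀ y ∈ V₁, Ω x y = 0 := fun x hx y hy => by
    rw [← LinearMap.IsAlt.neg hΩalt, horth y hy x hx, neg_zero]
  have hA₂0 : ∀ Z ∈ V₂, A Z = 0 :=
    eq_zero_of_ricciType_eq_zero Ω A V₁ V₂ hV₁ horth hnd₁ hA₂ fun X hX Y hY Z hZ =>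
      (smul_eq_zero_iff_right hc).mp (hR X Y Z ▸ hR₁₂ X hX Y hY Z hZ)
  have hA₁0 : ∀ Z ∈ V₁, A Z = 0 :=
    eq_zero_of_ricciType_eq_zero Ω A V₂ V₁ hV₂ horth' hnd₂ hA₁ fun X hX Y hY Z hZ =>
      (smul_eq_zero_iff_right hc).mp (hR X Y Z ▸ hR₂₁ X hX Y hY Z hZ)
  have hA0 : A = 0 := by
    rw [← LinearMap.ker_eq_top, eq_top_iff, ← hsup]
    exact sup_le hA₁0 hA₂0
  exact ⟨hA0, fun X Y Z => by simp [hR, hA0]⟩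
end

section
/- Let (V, Ω) be a real symplectic vector space of dimension 2n (n ≥ 2), let A be an infinitesimally symplectic endomorphism of V, and let R be the Ricci-type curvature operator associated to A. If A commutes with every curvature endomorphism, i.e. A ∘ R(X,Y) = R(X,Y) ∘ A for all X,Y ∈ V, then there exists a real number λ such that A² = λ·Id_V. (First assertion of Theorem 2.) -/
open Module

/-- First assertion of Theorem 2: if A commutes with every Ricci-type curvature
endomorphism then A² is a multiple of the identity. -/
theorem stmt_1
    {V : Type*} [AddCommGroup V] [Module ℝ V] [FiniteDimensional ℝ V]
    (n : ℕ) (hn : 2 ≤ n) (hdim : finrank ℝ V = 2 * n)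
    (Ω : V →ₗ[ℝ] V →ₗ[ℝ] ℝ)
    (hΩalt : ∀ x, Ω x x = 0)
    (hΩnd : ∀ x, (∀ y, Ω x y = 0) → x = 0)
    (A : V →ₗ[ℝ] V)
    (hA : ∀ X Y, Ω (A X) Y + Ω X (A Y) = 0)
    (R : V → V → V → V)
    (hR : ∀ X Y Z, R X Y Z = (2 * ((n : ℝ) + 1))⁻¹ •
      ((2 * Ω X Y) • A Z + Ω X Z • A Y - Ω Y (A Z) • X - Ω Y Z • A X + Ω X (A Z) • Y))
    (hcomm : ∀ X Y Z, A (R X Y Z) = R X Y (A Z)) :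
    ∃ l : ℝ, A ∘ₗ A = l • LinearMap.id := by
  have hn0 : (n : ℝ) ≠ 0 := by positivity
  have hc : (2 * ((n : ℝ) + 1))⁻¹ ≠ 0 := by positivity
  have hsymm : ∀ X Z, Ω (A (A X)) Z = Ω X (A (A Z)) := fun X Z => by
    linarith [hA (A X) Z, hA X (A Z)]
  have hkey : ∀ X Z, Ω X Z • (A ∘ₗ A) - (Ω.flip Z).smulRight (A (A X))
      + (Ω.flip (A (A Z))).smulRight X - Ω X (A (A Z)) • LinearMap.id = 0 := by
    intro X Z
    ext Y
    have h := hcomm X Y Z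
    rw [hR, hR, map_smul] at h
    have h' := smul_right_injective V hc h
    simp only [map_add, map_sub, map_smul] at h'
    simp only [LinearMap.sub_apply, LinearMap.add_apply, LinearMap.smul_apply,
      LinearMap.comp_apply, LinearMap.smulRight_apply, LinearMap.flip_apply,
      LinearMap.id_apply, LinearMap.zero_apply]
    rw [← sub_eq_zero] at h'
    rw [← h']
    abel
  have htrace : ∀ X Z, Ω X Z * LinearMap.trace ℝ V (A ∘ₗ A) = 2 * n * Ω X (A (A Z)) := by
    intro X Z
    have h := congrArg (LinearMap.trace ℝ V) (hkey X Z)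
    simp only [map_sub, map_add, map_smul, map_zero, LinearMap.trace_smulRight,
      LinearMap.flip_apply, LinearMap.trace_id, hdim, hsymm, smul_eq_mul] at h
    push_cast at h
    linarith
  refine ⟨LinearMap.trace ℝ V (A ∘ₗ A) / (2 * n), ?_⟩
  ext X
  rw [← sub_eq_zero]
  refine hΩnd _ fun Y => ?_
  have h := htrace X Y
  simp only [LinearMap.comp_apply, LinearMap.smul_apply, LinearMap.id_apply, map_sub,
    map_smul, LinearMap.sub_apply, smul_eq_mul, hsymm]
  field_simp
  linarith
end

section
/- Let (V, Ω) be a real symplectic vector space of dimension 2n (n ≥ 2) and let A be an infinitesimally symplectic endomorphism of V satisfying the identity −Ω(X,Z)·A²Y + Ω(Y,Z)·A²X = Ω(Y,A²Z)·X − Ω(X,A²Z)·Y for all X,Y,Z ∈ V. Then there exists a real number λ such that A² = λ·Id_V. -/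
open Module

/-- If an infinitesimally symplectic endomorphism A satisfies the displayed
identity, then A² is a multiple of the identity. -/
theorem stmt_2
    {V : Type*} [AddCommGroup V] [Module ℝ V] [FiniteDimensional ℝ V]
    (n : ℕ) (hn : 2 ≤ n) (hdim : finrank ℝ V = 2 * n)
    (Ω : V →ₗ[ℝ] V →ₗ[ℝ] ℝ)
    (hΩalt : ∀ x, Ω x x = 0)
    (hΩnd : ∀ x, (∀ y, Ω x y = 0) → x = 0)
    (A : V →ₗ[ℝ] V)
    (hA : ∀ X Y, Ω (A X) Y + Ω X (A Y) = 0)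
    (hid : ∀ X Y Z, -(Ω X Z) • A (A Y) + Ω Y Z • A (A X)
      = Ω Y (A (A Z)) • X - Ω X (A (A Z)) • Y) :
    ∃ l : ℝ, A ∘ₗ A = l • LinearMap.id := by
  have hanti : ∀ x y, Ω x y = -Ω y x := fun x y => by
    have h := hΩalt (x + y)
    simp only [map_add, LinearMap.add_apply, hΩalt] at h
    linarith
  have hself : ∀ X, Ω X (A (A X)) = 0 := fun X => by
    linarith [hA X (A X), hΩalt (A X)]
  have hmul : ∀ X, ∃ c : ℝ, A (A X) = c • X := fun X => by
    by_cases hX : X = 0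
    · exact ⟨0, by simp [hX]⟩
    obtain ⟨Y, hY⟩ : ∃ Y, Ω Y X ≠ 0 := by
      by_contra! h
      exact hX (hΩnd X fun y => by rw [hanti, h, neg_zero])
    have h := hid X Y X
    simp only [hΩalt, hself, neg_zero, zero_smul, zero_add, sub_zero] at h
    refine ⟨(Ω Y X)⁻¹ * Ω Y (A (A X)), ?_⟩
    rw [mul_smul, ← h, inv_smul_smul₀ hY]
  refine LinearMap.exists_eq_smul_id_of_forall_notLinearIndependent fun v hv => ?_
  obtain ⟨c, hc⟩ := hmul v
  have h := LinearIndependent.pair_iff.1 hv c (-1) (by simp [hc])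
  norm_num at h
end

section
/- Let (V, Ω) be a real symplectic vector space of dimension 2n (n ≥ 2), let A be an infinitesimally symplectic endomorphism of V with A² = λ·Id_V for some real number λ, and let R be the Ricci-type curvature operator associated to A. Then A commutes with every curvature endomorphism: A ∘ R(X,Y) = R(X,Y) ∘ A for all X,Y ∈ V. -/
open Module

/-- If A² = λ·Id then A commutes with every Ricci-type curvature endomorphism. -/
theorem stmt_3
    {V : Type*} [AddCommGroup V] [Module ℝ V] [FiniteDimensional ℝ V]
    (n : ℕ) (hn : 2 ≤ n) (hdim : finrank ℝ V = 2 * n)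
    (Ω : V →ₗ[ℝ] V →ₗ[ℝ] ℝ)
    (hΩalt : ∀ x, Ω x x = 0)
    (hΩnd : ∀ x, (∀ y, Ω x y = 0) → x = 0)
    (A : V →ₗ[ℝ] V)
    (hA : ∀ X Y, Ω (A X) Y + Ω X (A Y) = 0)
    (l : ℝ) (hl : A ∘ₗ A = l • LinearMap.id)
    (R : V → V → V → V)
    (hR : ∀ X Y Z, R X Y Z = (2 * ((n : ℝ) + 1))⁻¹ •
      ((2 * Ω X Y) • A Z + Ω X Z • A Y - Ω Y (A Z) • X - Ω Y Z • A X + Ω X (A Z) • Y)) :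
    ∀ X Y Z, A (R X Y Z) = R X Y (A Z) := by
  intro X Y Z
  have hAA : ∀ W, A (A W) = l • W := fun W => by
    simpa using LinearMap.congr_fun hl W
  rw [hR, hR, map_smul]
  congr 1
  simp only [map_add, map_sub, map_smul, hAA, smul_eq_mul]
  module
end

section
/- Let (V, Ω) be a real symplectic vector space of dimension 2n (n ≥ 2), let A be an infinitesimally symplectic endomorphism of V, and let R be the Ricci-type curvature operator associated to A. Then each curvature endomorphism R(X,Y) is itself infinitesimally symplectic: Ω(R(X,Y)Z, W) + Ω(Z, R(X,Y)W) = 0 for all X,Y,Z,W ∈ V. -/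
open Module

/-- Each Ricci-type curvature endomorphism R(X,Y) is infinitesimally symplectic. -/
theorem stmt_6
    {V : Type*} [AddCommGroup V] [Module ℝ V] [FiniteDimensional ℝ V]
    (n : ℕ) (hn : 2 ≤ n) (hdim : finrank ℝ V = 2 * n)
    (Ω : V →ₗ[ℝ] V →ₗ[ℝ] ℝ)
    (hΩalt : ∀ x, Ω x x = 0)
    (hΩnd : ∀ x, (∀ y, Ω x y = 0) → x = 0)
    (A : V →ₗ[ℝ] V)
    (hA : ∀ X Y, Ω (A X) Y + Ω X (A Y) = 0)
    (R : V → V → V → V)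
    (hR : ∀ X Y Z, R X Y Z = (2 * ((n : ℝ) + 1))⁻¹ •
      ((2 * Ω X Y) • A Z + Ω X Z • A Y - Ω Y (A Z) • X - Ω Y Z • A X + Ω X (A Z) • Y)) :
    ∀ X Y Z W, Ω (R X Y Z) W + Ω Z (R X Y W) = 0 := by
  have skew : ∀ x y, Ω x y = -Ω y x := fun x y => by
    have h := hΩalt (x + y)
    simp only [map_add, LinearMap.add_apply, hΩalt] at h
    linarith
  have move : ∀ x y, Ω (A x) y = -Ω x (A y) := fun x y => by linarith [hA x y]
  have symm : ∀ x y, Ω x (A y) = Ω y (A x) := fun x y => by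
    rw [skew x (A y), move y x, neg_neg]
  intro X Y Z W
  simp only [hR, map_add, map_sub, map_smul, LinearMap.add_apply, LinearMap.sub_apply,
    LinearMap.smul_apply, smul_eq_mul, move]
  rw [skew Z X, skew Z Y, symm Z X, symm Z Y]
  ring
end

section
/- Let (V, Ω) be a real symplectic vector space of dimension 2n (n ≥ 2), let A be an infinitesimally symplectic endomorphism of V, and let R be the Ricci-type curvature operator associated to A. Then the linear span of the set of curvature endomorphisms {R(X,Y) : X,Y ∈ V} equals the set {A∘B + B∘A : B an Ω-symmetric endomorphism of V}. (First assertion of the Lemma of Section 4, valid for any A.) -/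
open Module

section RankTwo

variable {V : Type*} [AddCommGroup V] [Module ℝ V]

/-- The endomorphism `Z ↦ Ω(X,Z) Y - Ω(Y,Z) X + Ω(X,Y) Z`. -/
def wedgeEnd (Ω : V →ₗ[ℝ] V →ₗ[ℝ] ℝ) (X Y : V) : V →ₗ[ℝ] V :=
  (Ω X).smulRight Y - (Ω Y).smulRight X + Ω X Y • LinearMap.id

theorem wedgeEnd_apply (Ω : V →ₗ[ℝ] V →ₗ[ℝ] ℝ) (X Y Z : V) :
    wedgeEnd Ω X Y Z = Ω X Z • Y - Ω Y Z • X + Ω X Y • Z := by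
  simp [wedgeEnd]

theorem wedgeEnd_symmetric (Ω : V →ₗ[ℝ] V →ₗ[ℝ] ℝ) (hΩ : ∀ x y, Ω x y = -Ω y x) (X Y Z W : V) :
    Ω (wedgeEnd Ω X Y Z) W = Ω Z (wedgeEnd Ω X Y W) := by
  simp only [wedgeEnd_apply, map_add, map_sub, map_smul, LinearMap.add_apply,
    LinearMap.sub_apply, LinearMap.smul_apply, smul_eq_mul]
  rw [hΩ Z X, hΩ Z Y]
  ring

/-- A basis has an `Ω`-dual family for a nondegenerate form `Ω`. -/
theorem exists_dual_family [FiniteDimensional ℝ V] (Ω : V →ₗ[ℝ] V →ₗ[ℝ] ℝ)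
    (hΩnd : ∀ x, (∀ y, Ω x y = 0) → x = 0) {ι : Type*} (b : Basis ι ℝ V) :
    ∃ f : ι → V, ∀ i, Ω (f i) = b.coord i := by
  have hinj : Function.Injective Ω := by
    rw [injective_iff_map_eq_zero]
    exact fun x hx => hΩnd x fun y => by rw [hx, LinearMap.zero_apply]
  have hsurj : Function.Surjective Ω :=
    (LinearMap.injective_iff_surjective_of_finrank_eq_finrank
      (Subspace.dual_finrank_eq (K := ℝ) (V := V)).symm).1 hinj
  choose f hf using fun i => hsurj (b.coord i)
  exact ⟨f, hf⟩

/-- Up to a multiple of the identity, twice an `Ω`-symmetric `B` is a sum of `wedgeEnd Ω X Y`. -/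
theorem sum_wedgeEnd {ι : Type*} [Fintype ι] (Ω : V →ₗ[ℝ] V →ₗ[ℝ] ℝ)
    (hΩ : ∀ x y, Ω x y = -Ω y x) (hΩnd : ∀ x, (∀ y, Ω x y = 0) → x = 0)
    (b : Basis ι ℝ V) (f : ι → V) (hf : ∀ i, Ω (f i) = b.coord i)
    (B : V →ₗ[ℝ] V) (hB : ∀ X Y, Ω (B X) Y = Ω X (B Y)) :
    ∑ i, wedgeEnd Ω (f i) (B (b i)) =
      (2 : ℝ) • B + (∑ i, Ω (f i) (B (b i))) • LinearMap.id := by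
  have hexp (Z : V) : ∑ i, Ω (f i) Z • b i = Z := by
    simp only [hf, Basis.coord_apply, b.sum_repr]
  have hdual (W : V) : ∑ i, Ω (b i) W • f i = -W := by
    rw [← add_eq_zero_iff_eq_neg]
    refine hΩnd _ fun Z => ?_
    have h : Ω W Z = ∑ i, Ω (f i) Z * Ω W (b i) := by
      conv_lhs => rw [← hexp Z]
      simp
    simp only [map_add, map_sum, map_smul, LinearMap.add_apply, LinearMap.sum_apply,
      LinearMap.smul_apply, smul_eq_mul]
    rw [h, ← Finset.sum_add_distrib]
    refine Finset.sum_eq_zero fun i _ => ?_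
    rw [hΩ W (b i)]
    ring
  ext Z
  have h₁ : ∑ i, Ω (f i) Z • B (b i) = B Z := by
    conv_rhs => rw [← hexp Z]
    simp
  have h₂ : ∑ i, Ω (B (b i)) Z • f i = -B Z := by
    simp only [hB, hdual]
  simp only [LinearMap.sum_apply, wedgeEnd_apply, Finset.sum_add_distrib, Finset.sum_sub_distrib,
    h₁, h₂, ← Finset.sum_smul, LinearMap.add_apply, LinearMap.smul_apply, LinearMap.id_apply]
  module

/-- For a symplectic form, the endomorphisms `wedgeEnd Ω X Y` span all `Ω`-symmetric ones. -/
theorem mem_span_wedgeEnd [FiniteDimensional ℝ V] (Ω : V →ₗ[ℝ] V →ₗ[ℝ] ℝ)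
    (hΩ : ∀ x y, Ω x y = -Ω y x) (hΩnd : ∀ x, (∀ y, Ω x y = 0) → x = 0)
    (B : V →ₗ[ℝ] V) (hB : ∀ X Y, Ω (B X) Y = Ω X (B Y)) :
    B ∈ Submodule.span ℝ {C : V →ₗ[ℝ] V | ∃ X Y, C = wedgeEnd Ω X Y} := by
  set S := Submodule.span ℝ {C : V →ₗ[ℝ] V | ∃ X Y, C = wedgeEnd Ω X Y}
  have b := finBasis ℝ V
  obtain ⟨f, hf⟩ := exists_dual_family Ω hΩnd b
  have key (C : V →ₗ[ℝ] V) (hC : ∀ X Y, Ω (C X) Y = Ω X (C Y)) :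
      (2 : ℝ) • C + (∑ i, Ω (f i) (C (b i))) • LinearMap.id ∈ S := by
    rw [← sum_wedgeEnd Ω hΩ hΩnd b f hf C hC]
    exact Submodule.sum_mem _ fun i _ => Submodule.subset_span ⟨_, _, rfl⟩
  have hid : (LinearMap.id : V →ₗ[ℝ] V) ∈ S := by
    have h := key LinearMap.id fun _ _ => rfl
    rw [← add_smul] at h
    refine (Submodule.smul_mem_iff S ?_).1 h
    have hone (i) : Ω (f i) (b i) = 1 := by
      rw [hf, Basis.coord_apply, Basis.repr_self, Finsupp.single_eq_same]
    have hnonneg : 0 ≤ ∑ i, Ω (f i) (LinearMap.id (R := ℝ) (b i)) :=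
      Finset.sum_nonneg fun i _ => (hone i).symm ▸ zero_le_one
    positivity
  exact (Submodule.smul_mem_iff S two_ne_zero).1
    ((Submodule.add_mem_iff_left S (S.smul_mem _ hid)).1 (key B hB))

end RankTwo

/-- First assertion of the Lemma of Section 4: the span of the curvature
endomorphisms equals {A∘B + B∘A : B Ω-symmetric}. -/
theorem stmt_7
    {V : Type*} [AddCommGroup V] [Module ℝ V] [FiniteDimensional ℝ V]
    (n : ℕ) (hn : 2 ≤ n) (hdim : finrank ℝ V = 2 * n)
    (Ω : V →ₗ[ℝ] V →ₗ[ℝ] ℝ)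
    (hΩalt : ∀ x, Ω x x = 0)
    (hΩnd : ∀ x, (∀ y, Ω x y = 0) → x = 0)
    (A : V →ₗ[ℝ] V)
    (hA : ∀ X Y, Ω (A X) Y + Ω X (A Y) = 0)
    (R : V → V → V →ₗ[ℝ] V)
    (hR : ∀ X Y Z, R X Y Z = (2 * ((n : ℝ) + 1))⁻¹ •
      ((2 * Ω X Y) • A Z + Ω X Z • A Y - Ω Y (A Z) • X - Ω Y Z • A X + Ω X (A Z) • Y)) :
    (Submodule.span ℝ {C : V →ₗ[ℝ] V | ∃ X Y, C = R X Y} : Set (V →ₗ[ℝ] V))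
      = {C : V →ₗ[ℝ] V | ∃ B : V →ₗ[ℝ] V,
          (∀ X Y, Ω (B X) Y = Ω X (B Y)) ∧ C = A ∘ₗ B + B ∘ₗ A} := by
  have hΩ (x y : V) : Ω x y = -Ω y x := by
    have h := hΩalt (x + y)
    simp only [map_add, LinearMap.add_apply, hΩalt] at h
    linarith
  have hn' : (2 * ((n : ℝ) + 1)) ≠ 0 := by positivity
  have hRW (X Y : V) : R X Y =
      (2 * ((n : ℝ) + 1))⁻¹ • (A ∘ₗ wedgeEnd Ω X Y + wedgeEnd Ω X Y ∘ₗ A) := by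
    ext Z
    simp only [hR, LinearMap.smul_apply, LinearMap.add_apply, LinearMap.comp_apply,
      wedgeEnd_apply, map_add, map_sub, map_smul]
    module
  ext C
  simp only [SetLike.mem_coe, Set.mem_ofPred_eq]
  constructor
  · intro hC
    induction hC using Submodule.span_induction with
    | mem C hC =>
      obtain ⟨X, Y, rfl⟩ := hC
      refine ⟨(2 * ((n : ℝ) + 1))⁻¹ • wedgeEnd Ω X Y, fun Z W => ?_, ?_⟩
      · simp only [LinearMap.smul_apply, map_smul, wedgeEnd_symmetric Ω hΩ]
      · rw [hRW, LinearMap.comp_smul, LinearMap.smul_comp, smul_add]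
    | zero => exact ⟨0, by simp, by simp⟩
    | add C D _ _ hC hD =>
      obtain ⟨B, hB, rfl⟩ := hC
      obtain ⟨B', hB', rfl⟩ := hD
      refine ⟨B + B', fun Z W => ?_, ?_⟩
      · simp only [LinearMap.add_apply, map_add, hB, hB']
      · rw [LinearMap.comp_add, LinearMap.add_comp]
        abel
    | smul a C _ hC =>
      obtain ⟨B, hB, rfl⟩ := hC
      refine ⟨a • B, fun Z W => ?_, ?_⟩
      · simp only [LinearMap.smul_apply, map_smul, hB]
      · rw [LinearMap.comp_smul, LinearMap.smul_comp, smul_add]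
  · rintro ⟨B, hB, rfl⟩
    have hmem := mem_span_wedgeEnd Ω hΩ hΩnd B hB
    clear hB
    induction hmem using Submodule.span_induction with
    | mem B hB =>
      obtain ⟨X, Y, rfl⟩ := hB
      rw [← Submodule.smul_mem_iff _ (inv_ne_zero hn'), ← hRW]
      exact Submodule.subset_span ⟨X, Y, rfl⟩
    | zero => simp
    | add B B' _ _ hB hB' =>
      rw [LinearMap.comp_add, LinearMap.add_comp, add_add_add_comm]
      exact Submodule.add_mem _ hB hB'
    | smul a B _ hB =>
      rw [LinearMap.comp_smul, LinearMap.smul_comp, ← smul_add]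
      exact Submodule.smul_mem _ a hB
end

section
/- Let (V, Ω) be a real symplectic vector space of dimension 2n (n ≥ 2) and let A be an infinitesimally symplectic endomorphism of V with A² = λ·Id_V for some real number λ ≠ 0. Then {A∘B + B∘A : B an Ω-symmetric endomorphism of V} = {C ∈ End(V) : C is infinitesimally symplectic and C∘A = A∘C}. (Second assertion of the Lemma of Section 4.) -/
open Module

/-- Second assertion of the Lemma of Section 4: when A² = λ·Id with λ ≠ 0,
{A∘B + B∘A : B Ω-symmetric} is exactly the set of infinitesimally symplectic
endomorphisms commuting with A. -/
theorem stmt_9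
    {V : Type*} [AddCommGroup V] [Module ℝ V] [FiniteDimensional ℝ V]
    (n : ℕ) (hn : 2 ≤ n) (hdim : finrank ℝ V = 2 * n)
    (Ω : V →ₗ[ℝ] V →ₗ[ℝ] ℝ)
    (hΩalt : ∀ x, Ω x x = 0)
    (hΩnd : ∀ x, (∀ y, Ω x y = 0) → x = 0)
    (A : V →ₗ[ℝ] V)
    (hA : ∀ X Y, Ω (A X) Y + Ω X (A Y) = 0)
    (l : ℝ) (hl : l ≠ 0) (hA2 : A ∘ₗ A = l • LinearMap.id) :
    {C : V →ₗ[ℝ] V | ∃ B : V →ₗ[ℝ] V,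
        (∀ X Y, Ω (B X) Y = Ω X (B Y)) ∧ C = A ∘ₗ B + B ∘ₗ A}
      = {C : V →ₗ[ℝ] V |
          (∀ X Y, Ω (C X) Y + Ω X (C Y) = 0) ∧ C ∘ₗ A = A ∘ₗ C} := by
  have hAA (x : V) : A (A x) = l • x := by
    simpa using LinearMap.congr_fun hA2 x
  ext C
  simp only [Set.mem_ofPred_eq]
  constructor
  · rintro ⟨B, hB, rfl⟩
    refine ⟨fun X Y => ?_, ?_⟩
    · have h₁ := hA (B X) Y
      have h₂ := hA X (B Y)
      have h₃ := hB (A X) Y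
      have h₄ := hB X (A Y)
      simp only [LinearMap.add_apply, LinearMap.comp_apply, map_add]
      linarith
    · ext x
      simp only [LinearMap.add_apply, LinearMap.comp_apply, map_add, hAA, map_smul]
      abel
  · rintro ⟨hC, hCA⟩
    have hcomm (x : V) : C (A x) = A (C x) := LinearMap.congr_fun hCA x
    refine ⟨(2 * l)⁻¹ • (A ∘ₗ C), fun X Y => ?_, ?_⟩
    · have h₁ := hA (C X) Y
      have h₂ := hC X (A Y)
      rw [hcomm] at h₂
      have h : Ω (A (C X)) Y = Ω X (A (C Y)) := by linarith
      simp [h]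
    · ext x
      simp only [LinearMap.add_apply, LinearMap.comp_apply, LinearMap.smul_apply, map_smul,
        hcomm, hAA, smul_smul, ← add_smul]
      rw [show (2 * l)⁻¹ * l + (2 * l)⁻¹ * l = 1 by field_simp; norm_num, one_smul]
end

section
/- Let (V, Ω) be a real symplectic vector space of dimension 2n (n ≥ 2), let A be an infinitesimally symplectic endomorphism of V, let R be the Ricci-type curvature operator associated to A, and let C be an infinitesimally symplectic endomorphism of V commuting with A. Then for all X,Y ∈ V: C∘R(X,Y) − R(X,Y)∘C = R(CX,Y) + R(X,CY). (Invariance of the Ricci-type curvature under the holonomy algebra; this is what makes the transvection triple construction close up.) -/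
open Module

/-- Invariance of the Ricci-type curvature under the holonomy algebra: if C is
infinitesimally symplectic and commutes with A, then
C∘R(X,Y) − R(X,Y)∘C = R(CX,Y) + R(X,CY). -/
theorem stmt_11
    {V : Type*} [AddCommGroup V] [Module ℝ V] [FiniteDimensional ℝ V]
    (n : ℕ) (hn : 2 ≤ n) (hdim : finrank ℝ V = 2 * n)
    (Ω : V →ₗ[ℝ] V →ₗ[ℝ] ℝ)
    (hΩalt : ∀ x, Ω x x = 0)
    (hΩnd : ∀ x, (∀ y, Ω x y = 0) → x = 0)
    (A : V →ₗ[ℝ] V)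
    (hA : ∀ X Y, Ω (A X) Y + Ω X (A Y) = 0)
    (R : V → V → V →ₗ[ℝ] V)
    (hR : ∀ X Y Z, R X Y Z = (2 * ((n : ℝ) + 1))⁻¹ •
      ((2 * Ω X Y) • A Z + Ω X Z • A Y - Ω Y (A Z) • X - Ω Y Z • A X + Ω X (A Z) • Y))
    (C : V →ₗ[ℝ] V)
    (hC : ∀ X Y, Ω (C X) Y + Ω X (C Y) = 0)
    (hCA : C ∘ₗ A = A ∘ₗ C) :
    ∀ X Y, C ∘ₗ R X Y - R X Y ∘ₗ C = R (C X) Y + R X (C Y) := by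
  intro X Y
  have hΩC : ∀ U W, Ω (C U) W = -Ω U (C W) := fun U W => eq_neg_of_add_eq_zero_left (hC U W)
  have hcomm : ∀ U, C (A U) = A (C U) := fun U => LinearMap.congr_fun hCA U
  ext Z
  simp only [LinearMap.sub_apply, LinearMap.add_apply, LinearMap.comp_apply, hR, map_smul,
    map_add, map_sub, hΩC, hcomm]
  module
end

section
/- Fix n ≥ 2, set k = 1/(2n+2), let a > 0 and let s ∈ ℝ satisfy s² = 2ka. Define j : Mₙ(ℝ) × ℝⁿ × ℝⁿ → M_{n+1}(ℝ) by j(C,X,ξ) = the block matrix with upper-left n×n block C − 2k·Tr(C)·I, upper-right column sX, lower-left row s·ξᵀ, and lower-right entry −2k·Tr(C). Then: (i) j is an injective ℝ-linear map; (ii) every j(C,X,ξ) has trace zero, i.e. lies in 𝔰𝔩(n+1,ℝ); (iii) j transforms the bracket [(C,X,ξ),(C′,X′,ξ′)] = ( [C,C′] + 2ka(⟨X,ξ′⟩ − ⟨X′,ξ⟩)·I + 2ka(X⊗ξ′ − X′⊗ξ), CX′ − C′X, −Cᵀξ′ + C′ᵀξ ) into the matrix commutator: j([(C,X,ξ),(C′,X′,ξ′)])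 = j(C,X,ξ)·j(C′,X′,ξ′) − j(C′,X′,ξ′)·j(C,X,ξ). (Identification of the transvection algebra with 𝔰𝔩(n+1,ℝ) in the case λ > 0 of Theorem 2.) -/
open Matrix

/-- Identification of the transvection algebra with 𝔰𝔩(n+1,ℝ) in the case λ > 0
of Theorem 2. -/
theorem stmt_16
    (n : ℕ) (hn : 2 ≤ n)
    (k a s : ℝ) (hk : k = 1 / (2 * (n : ℝ) + 2)) (ha : 0 < a)
    (hs : s ^ 2 = 2 * k * a)
    (j : Matrix (Fin n) (Fin n) ℝ × (Fin n → ℝ) × (Fin n → ℝ) →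
      Matrix (Fin (n + 1)) (Fin (n + 1)) ℝ)
    (hj : ∀ (C : Matrix (Fin n) (Fin n) ℝ) (X ξ : Fin n → ℝ),
      j (C, X, ξ) = Matrix.of fun i l =>
        Fin.lastCases
          (Fin.lastCases (-(2 * k * C.trace)) (fun l' => s * ξ l') l)
          (fun i' =>
            Fin.lastCases (s * X i')
              (fun l' => (C - (2 * k * C.trace) • (1 : Matrix (Fin n) (Fin n) ℝ)) i' l') l)
          i) :
    Function.Injective j ∧
    (∀ u v, j (u + v) = j u + j v) ∧
    (∀ (c : ℝ) u, j (c • u) = c • j u) ∧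
    (∀ u, (j u).trace = 0) ∧
    (∀ (C C' : Matrix (Fin n) (Fin n) ℝ) (X ξ X' ξ' : Fin n → ℝ),
      j (C * C' - C' * C
          + (2 * k * a * (X ⬝ᵥ ξ' - X' ⬝ᵥ ξ)) • (1 : Matrix (Fin n) (Fin n) ℝ)
          + (2 * k * a) • (vecMulVec X ξ' - vecMulVec X' ξ),
        C.mulVec X' - C'.mulVec X,
        -(Cᵀ.mulVec ξ') + C'ᵀ.mulVec ξ)
        = j (C, X, ξ) * j (C', X', ξ') - j (C', X', ξ') * j (C, X, ξ)) := by
  have hcc (C X ξ) (i l : Fin n) : j (C, X, ξ) i.castSucc l.castSucc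
      = C i l - 2 * k * C.trace * (1 : Matrix (Fin n) (Fin n) ℝ) i l := by
    simp [hj]
  have hcl (C X ξ) (i : Fin n) : j (C, X, ξ) i.castSucc (Fin.last n) = s * X i := by
    simp [hj]
  have hlc (C X ξ) (l : Fin n) : j (C, X, ξ) (Fin.last n) l.castSucc = s * ξ l := by
    simp [hj]
  have hll (C X ξ) : j (C, X, ξ) (Fin.last n) (Fin.last n) = -(2 * k * C.trace) := by
    simp [hj]
  have hk' : 2 * k * (n + 1) = 1 := by
    rw [hk]
    field_simp
  have hk0 : k ≠ 0 := by
    rintro rfl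
    simp at hk'
  have hs0 : s ≠ 0 := by
    rintro rfl
    simp [hk0, ha.ne'] at hs
  refine ⟨?_, ?_, ?_, ?_, ?_⟩
  · rintro ⟨C, X, ξ⟩ ⟨C', X', ξ'⟩ h
    have htr : C.trace = C'.trace := by
      have := congrFun₂ h (Fin.last n) (Fin.last n)
      simpa [hll, hk0] using this
    refine Prod.ext ?_ (Prod.ext ?_ ?_)
    · ext i l
      have := congrFun₂ h i.castSucc l.castSucc
      simpa [hcc, htr] using this
    · ext i
      have := congrFun₂ h i.castSucc (Fin.last n)
      simpa [hcl, hs0] using this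
    · ext i
      have := congrFun₂ h (Fin.last n) i.castSucc
      simpa [hlc, hs0] using this
  · rintro ⟨C, X, ξ⟩ ⟨C', X', ξ'⟩
    ext i l
    cases i using Fin.lastCases <;> cases l using Fin.lastCases <;>
      simp only [Prod.mk_add_mk, hcc, hcl, hlc, hll, trace_add, Matrix.add_apply,
        Pi.add_apply] <;> ring
  · rintro c ⟨C, X, ξ⟩
    ext i l
    cases i using Fin.lastCases <;> cases l using Fin.lastCases <;>
      simp only [Prod.smul_mk, hcc, hcl, hlc, hll, trace_smul, Matrix.smul_apply, Pi.smul_apply,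
        smul_eq_mul] <;> ring
  · rintro ⟨C, X, ξ⟩
    have hdiag : ∑ i, C i i = C.trace := rfl
    simp only [trace, diag_apply, Fin.sum_univ_castSucc, hcc, hll, one_apply_eq, mul_one,
      Finset.sum_sub_distrib, Finset.sum_const, Finset.card_univ, Fintype.card_fin, nsmul_eq_mul]
    simp only [hdiag]
    linear_combination -C.trace * hk'
  · intro C C' X ξ X' ξ'
    have htr : (C * C' - C' * C
          + (2 * k * a * (X ⬝ᵥ ξ' - X' ⬝ᵥ ξ)) • (1 : Matrix (Fin n) (Fin n) ℝ)
          + (2 * k * a) • (vecMulVec X ξ' - vecMulVec X' ξ)).trace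
        = a * (X ⬝ᵥ ξ' - X' ⬝ᵥ ξ) := by
      simp only [trace_add, trace_sub, trace_smul, trace_mul_comm C' C, trace_one,
        trace_vecMulVec, Fintype.card_fin, smul_eq_mul]
      linear_combination a * (X ⬝ᵥ ξ' - X' ⬝ᵥ ξ) * hk'
    ext i l
    cases i using Fin.lastCases with
    | last =>
      cases l using Fin.lastCases with
      | last =>
        simp only [hll, htr, Matrix.sub_apply, mul_apply, Fin.sum_univ_castSucc, hlc, hcl]
        have h (x y : Fin n → ℝ) : ∑ m, s * x m * (s * y m) = s ^ 2 * (y ⬝ᵥ x) := by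
          rw [dotProduct, Finset.mul_sum]
          exact Finset.sum_congr rfl fun _ _ => by ring
        rw [h, h, hs]
        ring
      | cast l =>
        simp only [hll, hlc, hcc, Matrix.sub_apply, mul_apply, Fin.sum_univ_castSucc]
        have h (D : Matrix (Fin n) (Fin n) ℝ) (x : Fin n → ℝ) (t : ℝ) :
            ∑ m, s * x m * (D m l - t * (1 : Matrix (Fin n) (Fin n) ℝ) m l)
              = s * ((Dᵀ *ᵥ x) l - t * x l) := by
          simp only [mulVec, dotProduct, transpose_apply, mul_sub, Finset.sum_sub_distrib,
            Finset.mul_sum, one_apply, mul_ite, mul_zero, mul_one, Finset.sum_ite_eq',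
            Finset.mem_univ, if_true]
          congr 1
          · exact Finset.sum_congr rfl fun _ _ => by ring
          · ring
        rw [h, h]
        simp only [Pi.add_apply, Pi.neg_apply]
        ring
    | cast i =>
      cases l using Fin.lastCases with
      | last =>
        simp only [hll, hcl, hcc, Matrix.sub_apply, mul_apply, Fin.sum_univ_castSucc]
        have h (D : Matrix (Fin n) (Fin n) ℝ) (x : Fin n → ℝ) (t : ℝ) :
            ∑ m, (D i m - t * (1 : Matrix (Fin n) (Fin n) ℝ) i m) * (s * x m)
              = s * ((D *ᵥ x) i - t * x i) := by
          simp only [mulVec, dotProduct, mul_sub, sub_mul, Finset.sum_sub_distrib,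
            Finset.mul_sum, one_apply, mul_ite, ite_mul, zero_mul, mul_zero, mul_one,
            Finset.sum_ite_eq, Finset.mem_univ, if_true]
          congr 1
          · exact Finset.sum_congr rfl fun _ _ => by ring
          · ring
        rw [h, h]
        simp only [Pi.sub_apply]
        ring
      | cast l =>
        have h (D E : Matrix (Fin n) (Fin n) ℝ) (t u : ℝ) :
            ∑ m, (D i m - t * (1 : Matrix (Fin n) (Fin n) ℝ) i m)
                * (E m l - u * (1 : Matrix (Fin n) (Fin n) ℝ) m l)
              = (D * E) i l - u * D i l - t * E i l
                + t * u * (1 : Matrix (Fin n) (Fin n) ℝ) i l := by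
          have := congrFun₂ (show (D - t • 1) * (E - u • 1)
            = D * E - u • D - t • E + (t * u) • (1 : Matrix (Fin n) (Fin n) ℝ) by
              simp only [sub_mul, mul_sub, smul_mul_assoc, mul_smul_comm, one_mul, mul_one,
                smul_sub, smul_smul]
              module) i l
          simpa only [mul_apply, Matrix.sub_apply, Matrix.add_apply, Matrix.smul_apply,
            smul_eq_mul] using this
        rw [hcc, htr, Matrix.sub_apply, mul_apply, mul_apply]
        simp only [Fin.sum_univ_castSucc, hcc, hcl, hlc, h]
        simp only [Matrix.sub_apply, Matrix.add_apply, Matrix.smul_apply, smul_eq_mul,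
          vecMulVec_apply]
        linear_combination -(X i * ξ' l - X' i * ξ l) * hs
end

section
/- Fix n ≥ 2 and p,q ≥ 0 with p + q = n, set k = 1/(2n+2), let b < 0 and let s ∈ ℂ satisfy s·s̄ = −kb. Let H ∈ Mₙ(ℂ) be the diagonal matrix with first p diagonal entries 1 and last q entries −1, and write ⟨v,w⟩ = vᴴHw for v,w ∈ ℂⁿ (conjugate-linear in v). Let 𝔲(p,q) = {C ∈ Mₙ(ℂ) : CᴴH + HC = 0}. Define j : 𝔲(p,q) × ℂⁿ → M_{n+1}(ℂ) by j(C,X) = the block matrix with upper-left block C − 2k·Tr(C)·I, upper-right column sX, lower-left row −s̄·XᴴH, and lower-right entry −2k·Tr(C). Then: (i) j is an injective ℝ-linear map; (ii) each j(C,X) satisfies j(C,X)ᴴH′ + H′j(C,X) = 0 and Tr(j(C,X)) = 0, where H′ = diag(H,1), i.e. j(C,X) ∈ 𝔰𝔲(p+1,q); (iii) j transforms the bracket [(C,X),(C′,X′)] = ( [C,C′] + kb(X·X′ᴴH − X′·XᴴH − 2i·Im(XᴴHX′)·I), CX′ − C′X ) into the matrix commutator. (Identification of the transvection algebra with 𝔰𝔲(p+1,q)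 in the case λ < 0 of Theorem 2.) -/
open Matrix

/-- A matrix `C` with `Cᴴ H + H C = 0`, `H` diagonal, satisfies this relation entrywise. -/
theorem star_mul_add_mul_eq_zero_of_diagonal {n : ℕ} {h : Fin n → ℂ}
    {C : Matrix (Fin n) (Fin n) ℂ}
    (hC : C.conjTranspose * diagonal h + diagonal h * C = 0) (i l : Fin n) :
    star (C l i) * h l + h i * C i l = 0 := by
  simpa [Matrix.mul_diagonal, Matrix.diagonal_mul] using congrFun (congrFun hC i) l

/-- A matrix that is skew for a nondegenerate diagonal form has imaginary trace. -/
theorem star_trace_eq_neg_of_diagonal {n : ℕ} {h : Fin n → ℂ} (h0 : ∀ i, h i ≠ 0)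
    {C : Matrix (Fin n) (Fin n) ℂ}
    (hC : C.conjTranspose * diagonal h + diagonal h * C = 0) :
    star C.trace = -C.trace := by
  simp only [Matrix.trace, Matrix.diag, star_sum, ← Finset.sum_neg_distrib]
  refine Finset.sum_congr rfl fun i _ => ?_
  have := star_mul_add_mul_eq_zero_of_diagonal hC i i
  apply mul_right_cancel₀ (h0 i)
  linear_combination this

/-- For skew `C`, `Xᴴ H C = -(C X)ᴴ H`. -/
theorem vecMul_vecMul_eq_neg_of_skew {n : ℕ} {H C : Matrix (Fin n) (Fin n) ℂ}
    (hC : C.conjTranspose * H + H * C = 0) (X : Fin n → ℂ) :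
    (star X ᵥ* H) ᵥ* C = -(star (C *ᵥ X) ᵥ* H) := by
  rw [Matrix.star_mulVec, Matrix.vecMul_vecMul, Matrix.vecMul_vecMul,
    eq_neg_of_add_eq_zero_right hC, Matrix.vecMul_neg]

/-- The commutator of the two values of a Hermitian form is twice its imaginary part. -/
theorem dotProduct_sub_dotProduct_swap_of_isHermitian {n : ℕ} {H : Matrix (Fin n) (Fin n) ℂ}
    (hH : H.IsHermitian) (X Y : Fin n → ℂ) :
    (star X ᵥ* H) ⬝ᵥ Y - (star Y ᵥ* H) ⬝ᵥ X
      = 2 * Complex.I * (((star X ⬝ᵥ H *ᵥ Y).im : ℝ) : ℂ) := by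
  have hswap : (star Y ᵥ* H) ⬝ᵥ X = star (star X ⬝ᵥ H *ᵥ Y) := by
    rw [Matrix.star_dotProduct, star_star, Matrix.star_mulVec, hH.eq]
  rw [hswap, ← Matrix.dotProduct_mulVec]
  generalize star X ⬝ᵥ H *ᵥ Y = z
  apply Complex.ext <;> simp
  ring

/-- Identification of the transvection algebra with 𝔰𝔲(p+1,q) in the case λ < 0
of Theorem 2. -/
theorem stmt_17
    (n p q : ℕ) (hn : 2 ≤ n) (hpq : p + q = n)
    (k b : ℝ) (hk : k = 1 / (2 * (n : ℝ) + 2)) (hb : b < 0)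
    (s : ℂ) (hs : s * (starRingEnd ℂ) s = -((k : ℂ) * (b : ℂ)))
    (H : Matrix (Fin n) (Fin n) ℂ)
    (hH : H = Matrix.diagonal fun i : Fin n => if (i : ℕ) < p then (1 : ℂ) else -1)
    (H' : Matrix (Fin (n + 1)) (Fin (n + 1)) ℂ)
    (hH' : H' = Matrix.diagonal fun i : Fin (n + 1) =>
      if (i : ℕ) < p ∨ (i : ℕ) = n then (1 : ℂ) else -1)
    (j : Matrix (Fin n) (Fin n) ℂ × (Fin n → ℂ) →
      Matrix (Fin (n + 1)) (Fin (n + 1)) ℂ)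
    (hj : ∀ (C : Matrix (Fin n) (Fin n) ℂ) (X : Fin n → ℂ),
      j (C, X) = Matrix.of fun i l =>
        Fin.lastCases
          (Fin.lastCases (-(2 * (k : ℂ) * C.trace))
            (fun l' => -(starRingEnd ℂ s) * Matrix.vecMul (star X) H l') l)
          (fun i' =>
            Fin.lastCases (s * X i')
              (fun l' =>
                (C - (2 * (k : ℂ) * C.trace) • (1 : Matrix (Fin n) (Fin n) ℂ)) i' l') l)
          i) :
    Set.InjOn j {P : Matrix (Fin n) (Fin n) ℂ × (Fin n → ℂ) |
      P.1.conjTranspose * H + H * P.1 = 0} ∧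
    (∀ u v, j (u + v) = j u + j v) ∧
    (∀ (c : ℝ) u, j (c • u) = c • j u) ∧
    (∀ (C : Matrix (Fin n) (Fin n) ℂ) (X : Fin n → ℂ),
      C.conjTranspose * H + H * C = 0 →
        (j (C, X)).conjTranspose * H' + H' * j (C, X) = 0 ∧ (j (C, X)).trace = 0) ∧
    (∀ (C C' : Matrix (Fin n) (Fin n) ℂ) (X X' : Fin n → ℂ),
      C.conjTranspose * H + H * C = 0 → C'.conjTranspose * H + H * C' = 0 →
        j (C * C' - C' * C
            + ((k : ℂ) * (b : ℂ)) •
              (vecMulVec X (Matrix.vecMul (star X') H)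
                - vecMulVec X' (Matrix.vecMul (star X) H)
                - (2 * Complex.I * (((star X ⬝ᵥ H.mulVec X').im : ℝ) : ℂ)) •
                    (1 : Matrix (Fin n) (Fin n) ℂ)),
          C.mulVec X' - C'.mulVec X)
          = j (C, X) * j (C', X') - j (C', X') * j (C, X)) := by
  set h : Fin n → ℂ := fun i => if (i : ℕ) < p then 1 else -1 with hh
  have hstar : ∀ i, star (h i) = h i := fun i => by simp only [hh]; split_ifs <;> simp
  have h0 : ∀ i, h i ≠ 0 := fun i => by simp only [hh]; split_ifs <;> simp
  have hHerm : H.IsHermitian := by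
    rw [hH, Matrix.IsHermitian, Matrix.diagonal_conjTranspose]
    exact congrArg _ (funext hstar)
  have hH'c : ∀ i : Fin n, (if ((i.castSucc : Fin (n + 1)) : ℕ) < p ∨
      ((i.castSucc : Fin (n + 1)) : ℕ) = n then (1 : ℂ) else -1) = h i := fun i => by
    simp [hh, i.isLt.ne]
  have hkR : k * (2 * (n : ℝ) + 2) = 1 := by rw [hk]; field_simp
  have hkC : (k : ℂ) * (2 * (n : ℂ) + 2) = 1 := by exact_mod_cast hkR
  have hk0 : (k : ℂ) ≠ 0 := left_ne_zero_of_mul_eq_one hkC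
  have hs0 : s ≠ 0 := by
    rintro rfl
    have hb0 : (b : ℂ) ≠ 0 := by exact_mod_cast hb.ne
    apply mul_ne_zero hk0 hb0
    simpa using hs.symm
  have j_ll : ∀ C X, j (C, X) (Fin.last n) (Fin.last n) = -(2 * (k : ℂ) * C.trace) :=
    fun C X => by simp [hj]
  have j_lc : ∀ C X (l : Fin n), j (C, X) (Fin.last n) l.castSucc
      = -(star s) * Matrix.vecMul (star X) H l := fun C X l => by simp [hj]
  have j_cl : ∀ C X (i : Fin n), j (C, X) i.castSucc (Fin.last n) = s * X i :=
    fun C X i => by simp [hj]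
  have j_cc : ∀ C X (i l : Fin n), j (C, X) i.castSucc l.castSucc
      = C i l - 2 * (k : ℂ) * C.trace * (1 : Matrix (Fin n) (Fin n) ℂ) i l :=
    fun C X i l => by simp [hj]
  clear_value h
  refine ⟨?_, ?_, ?_, ?_, ?_⟩
  · rintro ⟨C, X⟩ - ⟨D, Y⟩ - hCD
    have htr : C.trace = D.trace := by
      have := congrFun (congrFun hCD (Fin.last n)) (Fin.last n)
      rw [j_ll, j_ll] at this
      exact mul_left_cancel₀ (mul_ne_zero two_ne_zero hk0) (neg_injective this)
    refine Prod.ext (Matrix.ext fun i l => ?_) (funext fun i => ?_)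
    · have := congrFun (congrFun hCD i.castSucc) l.castSucc
      rw [j_cc, j_cc, htr] at this
      exact sub_left_injective this
    · have := congrFun (congrFun hCD i.castSucc) (Fin.last n)
      rw [j_cl, j_cl] at this
      exact mul_left_cancel₀ hs0 this
  · rintro ⟨C, X⟩ ⟨D, Y⟩
    rw [Prod.mk_add_mk]
    ext i l
    rw [Matrix.add_apply]
    induction i using Fin.lastCases <;> induction l using Fin.lastCases <;>
      simp only [j_ll, j_lc, j_cl, j_cc, Matrix.trace_add, star_add, Matrix.add_vecMul,
        Pi.add_apply, Matrix.add_apply] <;> ring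
  · rintro c ⟨C, X⟩
    rw [Prod.smul_mk]
    ext i l
    rw [Matrix.smul_apply]
    induction i using Fin.lastCases <;> induction l using Fin.lastCases <;>
      simp only [j_ll, j_lc, j_cl, j_cc, Matrix.trace_smul, star_smul, Matrix.smul_vecMul,
        Pi.smul_apply, Matrix.smul_apply, star_trivial, Complex.real_smul] <;> ring
  · intro C X hC
    rw [hH] at hC
    have htr := star_trace_eq_neg_of_diagonal h0 hC
    have hCe := star_mul_add_mul_eq_zero_of_diagonal hC
    have hkstar : star (k : ℂ) = k := Complex.conj_ofReal k
    refine ⟨?_, ?_⟩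
    · subst hH'
      ext i l
      rw [Matrix.add_apply, Matrix.mul_diagonal, Matrix.diagonal_mul, Matrix.conjTranspose_apply,
        Matrix.zero_apply]
      induction i using Fin.lastCases with
      | last =>
        induction l using Fin.lastCases with
        | last =>
          simp only [j_ll, star_neg, star_mul', htr, hkstar, Fin.val_last, or_true, if_true,
            star_ofNat]
          ring
        | cast l =>
          rw [hH'c]
          simp only [j_lc, j_cl, hH, Matrix.vecMul_diagonal, star_mul', Fin.val_last, or_true,
            if_true, Pi.star_apply]
          ring
      | cast i =>
        induction l using Fin.lastCases with
        | last =>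
          rw [hH'c]
          simp only [j_lc, j_cl, hH, Matrix.vecMul_diagonal, star_mul', Fin.val_last, or_true,
            if_true, Pi.star_apply, star_neg, star_star, hstar]
          ring
        | cast l =>
          rw [hH'c, hH'c]
          simp only [j_cc, star_sub, star_mul', htr, hkstar, star_ofNat]
          by_cases hil : i = l
          · subst hil
            simp only [Matrix.one_apply_eq, star_one]
            linear_combination hCe i i
          · simp only [Matrix.one_apply_ne hil, Matrix.one_apply_ne (Ne.symm hil), star_zero]
            linear_combination hCe i l
    · have hsum : ∑ i, C i i = C.trace := rfl
      rw [Matrix.trace, Fin.sum_univ_castSucc]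
      simp only [Matrix.diag, j_cc, j_ll, Matrix.one_apply_eq, Finset.sum_sub_distrib,
        Finset.sum_const, Finset.card_univ, Fintype.card_fin, hsum, nsmul_eq_mul]
      linear_combination -C.trace * hkC
  · intro C D X Y hC hD
    have hXD := vecMul_vecMul_eq_neg_of_skew hD X
    have hYC := vecMul_vecMul_eq_neg_of_skew hC Y
    have him := dotProduct_sub_dotProduct_swap_of_isHermitian hHerm X Y
    set m : ℂ := 2 * Complex.I * (((star X ⬝ᵥ H *ᵥ Y).im : ℝ) : ℂ)
    have htr : (C * D - D * C + ((k : ℂ) * (b : ℂ)) • (vecMulVec X (star Y ᵥ* H)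
        - vecMulVec Y (star X ᵥ* H) - m • (1 : Matrix (Fin n) (Fin n) ℂ))).trace
        = -((k : ℂ) * b * m * (n + 1)) := by
      simp only [Matrix.trace_add, Matrix.trace_sub, Matrix.trace_smul, Matrix.trace_vecMulVec,
        Matrix.trace_one, Fintype.card_fin, smul_eq_mul, Matrix.trace_mul_comm D C]
      rw [dotProduct_comm X, dotProduct_comm Y]
      linear_combination -(k : ℂ) * b * him
    have hs' : s * star s = -((k : ℂ) * b) := hs
    ext i l
    rw [Matrix.sub_apply, Matrix.mul_apply, Matrix.mul_apply, Fin.sum_univ_castSucc,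
      Fin.sum_univ_castSucc]
    have hmv : ∀ (A : Matrix (Fin n) (Fin n) ℂ) (Z : Fin n → ℂ) i,
      ∑ x, A i x * Z x = (A *ᵥ Z) i := fun _ _ _ => rfl
    have hvm : ∀ (A : Matrix (Fin n) (Fin n) ℂ) (Z : Fin n → ℂ) i,
      ∑ x, Z x * A x i = (Z ᵥ* A) i := fun _ _ _ => rfl
    have hdot : ∀ (Z W : Fin n → ℂ), ∑ x, Z x * W x = Z ⬝ᵥ W := fun _ _ => rfl
    have hone : ∀ (f : Fin n → ℂ) i,
        ∑ x, f x * (1 : Matrix (Fin n) (Fin n) ℂ) x i = f i := fun f i => by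
      simp [Matrix.one_apply]
    have hone' : ∀ (f : Fin n → ℂ) i,
        ∑ x, (1 : Matrix (Fin n) (Fin n) ℂ) i x * f x = f i := fun f i => by
      simp [Matrix.one_apply]
    induction i using Fin.lastCases with
    | last =>
      induction l using Fin.lastCases with
      | last =>
        simp only [j_ll, j_lc, j_cl, htr]
        have e : ∀ Z W : Fin n → ℂ, ∑ x, -star s * (star Z ᵥ* H) x * (s * W x)
            = -(s * star s) * ((star Z ᵥ* H) ⬝ᵥ W) := fun Z W => by
          rw [← hdot, Finset.mul_sum]
          exact Finset.sum_congr rfl fun _ _ => by ring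
        rw [e, e, hs']
        linear_combination (k : ℂ) * b * m * hkC - (k : ℂ) * b * him
      | cast l =>
        simp only [j_ll, j_lc, j_cc]
        have e : ∀ (Z : Fin n → ℂ) (A : Matrix (Fin n) (Fin n) ℂ) (t : ℂ),
            ∑ x, -star s * (star Z ᵥ* H) x * (A x l - t * (1 : Matrix (Fin n) (Fin n) ℂ) x l)
            = -star s * (((star Z ᵥ* H) ᵥ* A) l - t * (star Z ᵥ* H) l) := fun Z A t => by
          rw [← hvm, ← hone (star Z ᵥ* H) l, Finset.mul_sum, ← Finset.sum_sub_distrib,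
            Finset.mul_sum]
          exact Finset.sum_congr rfl fun _ _ => by ring
        rw [e, e, hXD, hYC, star_sub, Matrix.sub_vecMul]
        simp only [Pi.sub_apply, Pi.neg_apply]
        ring
    | cast i =>
      induction l using Fin.lastCases with
      | last =>
        simp only [j_ll, j_cl, j_cc]
        have e : ∀ (Z : Fin n → ℂ) (A : Matrix (Fin n) (Fin n) ℂ) (t : ℂ),
            ∑ x, (A i x - t * (1 : Matrix (Fin n) (Fin n) ℂ) i x) * (s * Z x)
            = s * ((A *ᵥ Z) i - t * Z i) := fun Z A t => by
          rw [← hmv, ← hone' Z i, Finset.mul_sum, ← Finset.sum_sub_distrib,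
            Finset.mul_sum]
          exact Finset.sum_congr rfl fun _ _ => by ring
        rw [e, e]
        simp only [Pi.sub_apply]
        ring
      | cast l =>
        simp only [j_lc, j_cl, j_cc, htr]
        have e : ∀ (A B : Matrix (Fin n) (Fin n) ℂ) (t u : ℂ),
            ∑ x, (A i x - t * (1 : Matrix (Fin n) (Fin n) ℂ) i x)
              * (B x l - u * (1 : Matrix (Fin n) (Fin n) ℂ) x l)
            = (A * B) i l - t * B i l - u * A i l
              + t * u * (1 : Matrix (Fin n) (Fin n) ℂ) i l := fun A B t u => by
          have : ((A - t • 1) * (B - u • 1)) i l = (A * B) i l - t * B i l - u * A i l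
              + t * u * (1 : Matrix (Fin n) (Fin n) ℂ) i l := by
            simp [sub_mul, mul_sub]
            ring
          rw [← this, Matrix.mul_apply]
          rfl
        rw [e, e]
        simp only [Matrix.add_apply, Matrix.sub_apply, Matrix.smul_apply, smul_eq_mul,
          vecMulVec_apply]
        linear_combination (k : ℂ) * b * m * (1 : Matrix (Fin n) (Fin n) ℂ) i l * hkC
          + (X i * (star Y ᵥ* H) l - Y i * (star X ᵥ* H) l) * hs'
end

section
/- Fix n ≥ 2. On the real vector space 𝔭 = ℝⁿ × ℝⁿ (elements written (X,ξ)) define the symplectic form Ω((X,ξ),(X′,ξ′)) = −⟨X,ξ′⟩ + ⟨X′,ξ⟩ and the endomorphism A(X,ξ) = (n+1)·(X,−ξ). Then A is infinitesimally symplectic for Ω, and the explicitly given trilinear map R((X,ξ),(X′,ξ′))(X″,ξ″) = ( X″·(⟨X′,ξ⟩ − ⟨X,ξ′⟩) − X·⟨X″,ξ′⟩ + X′·⟨X″,ξ⟩ , ξ′·⟨X,ξ″⟩ − ξ·⟨X′,ξ″⟩ − ξ″·(⟨X′,ξ⟩ − ⟨X,ξ′⟩) ) coincides with the Ricci-type curvature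 operator associated to A, i.e. R(u,v)w = (1/(2(n+1)))·[2Ω(u,v)Aw + Ω(u,w)Av − Ω(v,Aw)u − Ω(v,w)Au + Ω(u,Aw)v] for all u,v,w ∈ 𝔭. (The curvature of the canonical connection on SL(n+1,ℝ)/GL(n,ℝ) is of Ricci type.) -/
open Matrix

/-- The curvature of the canonical connection on SL(n+1,ℝ)/GL(n,ℝ) is of Ricci
type: on 𝔭 = ℝⁿ × ℝⁿ with Ω((X,ξ),(X′,ξ′)) = −⟨X,ξ′⟩ + ⟨X′,ξ⟩ and
A(X,ξ) = (n+1)(X,−ξ), the explicit curvature is the Ricci-type curvature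
operator associated to A. -/
theorem stmt_18
    (n : ℕ) (hn : 2 ≤ n)
    (Ω : ((Fin n → ℝ) × (Fin n → ℝ)) → ((Fin n → ℝ) × (Fin n → ℝ)) → ℝ)
    (hΩ : ∀ u v, Ω u v = -(u.1 ⬝ᵥ v.2) + v.1 ⬝ᵥ u.2)
    (A : ((Fin n → ℝ) × (Fin n → ℝ)) → ((Fin n → ℝ) × (Fin n → ℝ)))
    (hA : ∀ u, A u = (((n : ℝ) + 1) • u.1, -(((n : ℝ) + 1) • u.2)))
    (R : ((Fin n → ℝ) × (Fin n → ℝ)) → ((Fin n → ℝ) × (Fin n → ℝ)) →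
      ((Fin n → ℝ) × (Fin n → ℝ)) → ((Fin n → ℝ) × (Fin n → ℝ)))
    (hR : ∀ u v w, R u v w =
      ((v.1 ⬝ᵥ u.2 - u.1 ⬝ᵥ v.2) • w.1 - (w.1 ⬝ᵥ v.2) • u.1 + (w.1 ⬝ᵥ u.2) • v.1,
       (u.1 ⬝ᵥ w.2) • v.2 - (v.1 ⬝ᵥ w.2) • u.2 - (v.1 ⬝ᵥ u.2 - u.1 ⬝ᵥ v.2) • w.2)) :
    (∀ u v, Ω (A u) v + Ω u (A v) = 0) ∧
    (∀ u v w, R u v w = (2 * ((n : ℝ) + 1))⁻¹ •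
      ((2 * Ω u v) • A w + Ω u w • A v - Ω v (A w) • u - Ω v w • A u + Ω u (A w) • v)) := by
  have hN : (n : ℝ) + 1 ≠ 0 := by positivity
  refine ⟨fun u v => ?_, fun u v w => ?_⟩
  · simp only [hΩ, hA, smul_dotProduct, dotProduct_smul, dotProduct_neg,
      smul_eq_mul]
    ring
  · rw [hR]
    simp only [hΩ, hA, smul_dotProduct, dotProduct_smul, dotProduct_neg,
      smul_eq_mul]
    ext i
    all_goals
      simp only [Prod.fst_add, Prod.fst_sub, Prod.smul_fst, Prod.snd_add, Prod.snd_sub,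
        Prod.smul_snd, Pi.add_apply, Pi.sub_apply, Pi.smul_apply, Pi.neg_apply, smul_eq_mul]
      field_simp
      ring
end

section
/- Fix n ≥ 2 and p,q ≥ 0 with p + q = n. On V = ℂⁿ, regarded as a real vector space of dimension 2n, let ⟨v,w⟩ = Σ_{i≤p} v̄ᵢwᵢ − Σ_{j>p} v̄ⱼwⱼ (conjugate-linear in v), define the real symplectic form Ω(v,w) = Im⟨v,w⟩ and the real-linear endomorphism A(v) = −2(n+1)·i·v. Then A is infinitesimally symplectic for Ω, and the map R(v,w)z = v·⟨w,z⟩ − w·⟨v,z⟩ + z·(⟨w,v⟩ − ⟨v,w⟩) coincides with the Ricci-type curvature operator associated to A, i.e. R(v,w)z = (1/(2(n+1)))·[2Ω(v,w)Az + Ω(v,z)Aw − Ω(w,Az)v − Ω(w,z)Av + Ω(v,Az)w] for all v,w,z ∈ V. (The curvature of the canonical connection on SU(p+1,q)/U(p,q) is of Ricci type.) -/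
open Matrix Finset

/-- The curvature of the canonical connection on SU(p+1,q)/U(p,q) is of Ricci
type: on V = ℂⁿ with the signature-(p,q) Hermitian form h, Ω = Im h and
A(v) = −2(n+1)·i·v, the explicit curvature R(v,w)z = v⟨w,z⟩ − w⟨v,z⟩ +
z(⟨w,v⟩ − ⟨v,w⟩) is the Ricci-type curvature operator associated to A. -/
theorem stmt_19
    (n p q : ℕ) (hn : 2 ≤ n) (hpq : p + q = n)
    (h : (Fin n → ℂ) → (Fin n → ℂ) → ℂ)
    (hh : ∀ v w, h v w =
      ∑ i : Fin n, (if (i : ℕ) < p then 1 else -1) * (starRingEnd ℂ) (v i) * w i)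
    (Ω : (Fin n → ℂ) → (Fin n → ℂ) → ℝ)
    (hΩ : ∀ v w, Ω v w = (h v w).im)
    (A : (Fin n → ℂ) → (Fin n → ℂ))
    (hA : ∀ v, A v = (-(2 * ((n : ℝ) + 1)) * Complex.I : ℂ) • v)
    (R : (Fin n → ℂ) → (Fin n → ℂ) → (Fin n → ℂ) → (Fin n → ℂ))
    (hR : ∀ v w z, R v w z = h w z • v - h v z • w + (h w v - h v w) • z) :
    (∀ v w, Ω (A v) w + Ω v (A w) = 0) ∧
    (∀ v w z, R v w z = (2 * ((n : ℝ) + 1))⁻¹ •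
      ((2 * Ω v w) • A z + Ω v z • A w - Ω w (A z) • v - Ω w z • A v + Ω v (A z) • w)) := by
  have h_symm : ∀ v w, h w v = (starRingEnd ℂ) (h v w) := by
    intro v w
    rw [hh, hh, map_sum]
    refine Finset.sum_congr rfl fun i _ => ?_
    split_ifs <;> simp [mul_comm]
  have h_smul : ∀ (a : ℂ) v w, h v (a • w) = a * h v w := by
    intro a v w
    rw [hh, hh, Finset.mul_sum]
    refine Finset.sum_congr rfl fun i _ => ?_
    rw [Pi.smul_apply, smul_eq_mul]
    ring
  have smul_h : ∀ (a : ℂ) v w, h (a • v) w = (starRingEnd ℂ) a * h v w := by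
    intro a v w
    rw [h_symm w, h_smul, map_mul, ← h_symm]
  have hΩA : ∀ v w, Ω v (A w) = -(2 * ((n : ℝ) + 1)) * (h v w).re := by
    intro v w
    rw [hΩ, hA, h_smul]
    simp
  refine ⟨fun v w => ?_, fun v w z => ?_⟩
  · rw [hΩA, hΩ, hA, smul_h]
    simp
  · have hc : (n : ℝ) + 1 ≠ 0 := by positivity
    have hc' : ((n : ℝ) : ℂ) + 1 ≠ 0 := by exact_mod_cast hc
    ext i
    rw [hΩA, hΩA, hR, h_symm v w]
    simp only [hA, hΩ, Pi.add_apply, Pi.sub_apply, Pi.smul_apply, smul_eq_mul, Complex.real_smul]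
    obtain ⟨a, b⟩ := h w z
    obtain ⟨c, d⟩ := h v z
    obtain ⟨e, f⟩ := h v w
    simp only [Complex.mk_eq_add_mul_I, map_add, map_mul, Complex.conj_ofReal, Complex.conj_I]
    push_cast
    simp
    field_simp
    ring
end
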